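/- arXiv:1607.04322 — 2 statements merged into one kernel-verified Lean document; each statement's English description precedes it below -/
import Mathlib

section
/- Let (𝒜×ℬ, μ) be a finite joint probability space with maximal correlation ρ = ρ(𝒜,ℬ;μ) < 1, and let λ, η > 0. Then there exists d = d(μ, λ, η) ∈ ℕ such that for every n and all functions f : 𝒜^n → [−1,1], g : ℬ^n → [−1,1], there exist functions f₁ : 𝒜^n → [−1,1] and g₁ : ℬ^n → [−1,1] with E[f₁] = E[f], E[g₁] = E[g], |E_{(x,y)∼μ^{⊗n}}[f₁(x)g₁(y)] − E_{(x,y)∼μ^{⊗n}}[f(x)g(y)]| ≤ λ, and such that the squared L²(μ_A^{⊗n})-distance from f₁ to the subspace of functions of degree at most d is at most η, and the squared L²(μ_B^{⊗n})-distance from g₁ to the subspace of functions of degree at most d is at most η. -/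
open Finset MeasureTheory ProbabilityTheory Filter
open scoped Classical

noncomputable section

namespace NIS

/-- Expectation of `f` under the weight function `p` on a finite type. -/
def pmean {Ω : Type*} [Fintype Ω] (p : Ω → ℝ) (f : Ω → ℝ) : ℝ := ∑ ω, p ω * f ω

/-- Variance of `f` under the weight function `p` on a finite type. -/
def pvar {Ω : Type*} [Fintype Ω] (p : Ω → ℝ) (f : Ω → ℝ) : ℝ :=
  pmean p (fun ω => (f ω - pmean p f) ^ 2)

/-- `p` is a probability distribution on the finite type `Ω`. -/
def IsDist {Ω : Type*} [Fintype Ω] (p : Ω → ℝ) : Prop :=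
  (∀ ω, 0 ≤ p ω) ∧ ∑ ω, p ω = 1

/-- Probability of the event `E` under the weight function `p`. -/
def pprob {Ω : Type*} [Fintype Ω] (p : Ω → ℝ) (E : Ω → Prop) : ℝ :=
  ∑ ω, if E ω then p ω else 0

/-- Total variation distance between two distributions on a finite type. -/
def tvDist {Ω : Type*} [Fintype Ω] (p q : Ω → ℝ) : ℝ := (1 / 2) * ∑ ω, |p ω - q ω|

/-- Marginal on the first coordinate of a joint distribution. -/
def marginalA {A B : Type*} [Fintype A] [Fintype B] (μ : A × B → ℝ) : A → ℝ :=
  fun a => ∑ b, μ (a, b)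

/-- Marginal on the second coordinate of a joint distribution. -/
def marginalB {A B : Type*} [Fintype A] [Fintype B] (μ : A × B → ℝ) : B → ℝ :=
  fun b => ∑ a, μ (a, b)

/-- The Hirschfeld–Gebelein–Rényi maximal correlation of a finite joint distribution. -/
def maxCorr {A B : Type*} [Fintype A] [Fintype B] (μ : A × B → ℝ) : ℝ :=
  sSup { r | ∃ f : A → ℝ, ∃ g : B → ℝ,
    pmean (marginalA μ) f = 0 ∧ pmean (marginalB μ) g = 0 ∧
    pvar (marginalA μ) f = 1 ∧ pvar (marginalB μ) g = 1 ∧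
    pmean μ (fun ab => f ab.1 * g ab.2) = r }

/-- `n`-fold product distribution of a distribution `μA` on `A`. -/
def prodDist {A : Type*} [Fintype A] (μA : A → ℝ) (n : ℕ) : (Fin n → A) → ℝ :=
  fun x => ∏ i, μA (x i)

/-- `n`-fold product of a joint distribution `μ` on `A × B`, identified with a distribution on
`A^n × B^n`. -/
def prodPair {A B : Type*} [Fintype A] [Fintype B] (μ : A × B → ℝ) (n : ℕ) :
    (Fin n → A) × (Fin n → B) → ℝ :=
  fun p => ∏ i, μ (p.1 i, p.2 i)

/-- The influence of coordinate `i` on `f : A^n → ℝ` with respect to `μA^{⊗n}`: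
`Inf_i(f) = E_{x_{-i}}[Var_{x_i} f] = ½ E_{x, a}[(f(x) - f(x_i ← a))²]`. -/
def influence {A : Type*} [Fintype A] {n : ℕ} (μA : A → ℝ) (i : Fin n)
    (f : (Fin n → A) → ℝ) : ℝ :=
  (1 / 2) * ∑ x : Fin n → A, ∑ a : A,
    (∏ j, μA (x j)) * μA a * (f x - f (Function.update x i a)) ^ 2

/-- Total influence of `f`. -/
def totalInfluence {A : Type*} [Fintype A] {n : ℕ} (μA : A → ℝ)
    (f : (Fin n → A) → ℝ) : ℝ :=
  ∑ i, influence μA i f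

/-- `g` depends on at most `d` coordinates. -/
def DependsOnLE {A : Type*} {n : ℕ} (d : ℕ) (g : (Fin n → A) → ℝ) : Prop :=
  ∃ J : Finset (Fin n), J.card ≤ d ∧
    ∀ x y : Fin n → A, (∀ i ∈ J, x i = y i) → g x = g y

/-- `f` has degree at most `d`: it lies in the linear span of functions each depending on at
most `d` coordinates. -/
def degLE {A : Type*} {n : ℕ} (d : ℕ) (f : (Fin n → A) → ℝ) : Prop :=
  f ∈ Submodule.span ℝ { g : (Fin n → A) → ℝ | DependsOnLE d g }

/-- Restriction of `P` fixing the coordinates in `H` to the values of `ξ`; the result only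
depends on the coordinates outside `H`. -/
def restrictFn {A : Type*} {n : ℕ} (H : Finset (Fin n)) (ξ : Fin n → A)
    (P : (Fin n → A) → ℝ) : (Fin n → A) → ℝ :=
  fun x => P (fun i => if i ∈ H then ξ i else x i)

/-- The 2-dimensional Gaussian distribution `G(ρ)` with standard normal marginals and
correlation `ρ`. -/
def gauss2 (ρ : ℝ) : Measure (ℝ × ℝ) :=
  Measure.map (fun p : ℝ × ℝ => (p.1, ρ * p.1 + Real.sqrt (1 - ρ ^ 2) * p.2))
    ((gaussianReal 0 1).prod (gaussianReal 0 1))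

/-- The standard normal cumulative distribution function `Φ`. -/
def stdNormalCDF (t : ℝ) : ℝ := ((gaussianReal 0 1) (Set.Iic t)).toReal

/-- The inverse `Φ⁻¹` of the standard normal CDF (junk values outside `(0,1)`). -/
def stdNormalCDFInv : ℝ → ℝ := Function.invFun stdNormalCDF

/-- The ±1-valued threshold function: `thr t r = 1` if `r ≥ t`, and `-1` otherwise. -/
def thr (t r : ℝ) : ℝ := if t ≤ r then 1 else -1

/-- The Gaussian stability quantity `Γ̄_ρ(m, v)`. -/
def Gammabar (ρ m v : ℝ) : ℝ :=
  ∫ q : ℝ × ℝ, (if q.1 ≤ stdNormalCDFInv ((1 + m) / 2) then (1 : ℝ) else -1) *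
    (if q.2 ≤ stdNormalCDFInv ((1 + v) / 2) then (1 : ℝ) else -1) ∂(gauss2 ρ)

/-- Pushforward of `μ^{⊗n}` under the pair of maps `(f, g)`. -/
def push {A B U V : Type*} [Fintype A] [Fintype B] (μ : A × B → ℝ) (n : ℕ)
    (f : (Fin n → A) → U) (g : (Fin n → B) → V) : U × V → ℝ :=
  fun uv => ∑ z : Fin n → A × B,
    if f (fun i => (z i).1) = uv.1 ∧ g (fun i => (z i).2) = uv.2
    then ∏ i, μ (z i) else 0

/-- `ν` can be non-interactively simulated from `μ`. -/
def CanSimulate {A B U V : Type*} [Fintype A] [Fintype B] [Fintype U] [Fintype V]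
    (μ : A × B → ℝ) (ν : U × V → ℝ) : Prop :=
  ∃ f : (n : ℕ) → (Fin n → A) → U, ∃ g : (n : ℕ) → (Fin n → B) → V,
    Tendsto (fun n => tvDist (push μ n (f n) (g n)) ν) atTop (nhds 0)

/-- The doubly symmetric binary source `DSBS(ρ)`, as a distribution on `Bool × Bool`, where
`true` encodes `+1` and `false` encodes `-1`. -/
def DSBS (ρ : ℝ) : Bool × Bool → ℝ :=
  fun bv => if bv.1 = bv.2 then (1 + ρ) / 4 else (1 - ρ) / 4

/-- The ±1 value encoded by a Boolean. -/
def sgn (b : Bool) : ℝ := if b then 1 else -1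

/-- Minimum nonzero probability of an atom. -/
def minAtom {A : Type*} [Fintype A] (μA : A → ℝ) : ℝ :=
  sInf { x | ∃ a, μA a = x ∧ 0 < x }

/-- The hypercontractivity constant `C₄(α)`. -/
def C4 (α : ℝ) : ℝ :=
  if α = 1 / 2 then 3 else
    (((1 - α) / α) ^ ((3 : ℝ) / 4) - ((1 - α) / α) ^ (-((3 : ℝ) / 4))) /
    (((1 - α) / α) ^ ((1 : ℝ) / 4) - ((1 - α) / α) ^ (-((1 : ℝ) / 4)))

section Product

variable {A B : Type*} [Fintype A] [Fintype B] {n : ℕ}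

/-- The correlation `E[f(x) g(y)]` under the product distribution `μ^{⊗n}`. -/
def prodCorr (μ : A × B → ℝ) (f : (Fin n → A) → ℝ) (g : (Fin n → B) → ℝ) : ℝ :=
  ∑ x, ∑ y, (∏ i, μ (x i, y i)) * (f x * g y)

lemma pmean_prodPair (μ : A × B → ℝ) (f : (Fin n → A) → ℝ) (g : (Fin n → B) → ℝ) :
    pmean (prodPair μ n) (fun p => f p.1 * g p.2) = prodCorr μ f g := by
  simp only [pmean, prodPair, prodCorr, Fintype.sum_prod_type]

/-- The squared `L²` norm of `f` under `p^{⊗n}`. -/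
def normSqL2 (p : A → ℝ) (f : (Fin n → A) → ℝ) : ℝ :=
  pmean (prodDist p n) (fun x => f x ^ 2)

lemma normSqL2_nonneg {p : A → ℝ} (hp : ∀ a, 0 ≤ p a) (f : (Fin n → A) → ℝ) :
    0 ≤ normSqL2 p f :=
  Finset.sum_nonneg fun x _ =>
    mul_nonneg (Finset.prod_nonneg fun i _ => hp (x i)) (sq_nonneg (f x))

/-- The distribution of `(a, a)` for `a` distributed according to `p`. -/
def diagDist (p : A → ℝ) : A × A → ℝ := fun ab => if ab.1 = ab.2 then p ab.1 else 0

@[simp] lemma marginalA_diagDist (p : A → ℝ) : marginalA (diagDist p) = p := by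
  funext a; simp [marginalA, diagDist]

@[simp] lemma marginalB_diagDist (p : A → ℝ) : marginalB (diagDist p) = p := by
  funext a; simp [marginalB, diagDist]

lemma prodCorr_diagDist (p : A → ℝ) (f g : (Fin n → A) → ℝ) :
    prodCorr (diagDist p) f g = pmean (prodDist p n) (fun x => f x * g x) := by
  refine Finset.sum_congr rfl fun x _ => ?_
  rw [Finset.sum_eq_single x]
  · simp [diagDist, prodDist]
  · intro y _ hxy
    obtain ⟨i, hi⟩ : ∃ i, x i ≠ y i := by
      by_contra! h
      exact hxy (funext fun i => (h i).symm)
    rw [Finset.prod_eq_zero (Finset.mem_univ i) (by simp [diagDist, hi]), zero_mul]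
  · simp

lemma prodCorr_diagDist_self (p : A → ℝ) (f : (Fin n → A) → ℝ) :
    prodCorr (diagDist p) f f = normSqL2 p f := by
  simp [prodCorr_diagDist, normSqL2, sq]

lemma prodCorr_sum_sum {ι κ : Type*} (μ : A × B → ℝ) (s : Finset ι) (t : Finset κ)
    (a : ι → ℝ) (b : κ → ℝ) (f : ι → (Fin n → A) → ℝ) (g : κ → (Fin n → B) → ℝ) :
    prodCorr μ (fun x => ∑ i ∈ s, a i * f i x) (fun y => ∑ j ∈ t, b j * g j y) =
      ∑ i ∈ s, ∑ j ∈ t, a i * b j * prodCorr μ (f i) (g j) := by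
  have h : ∀ (x : Fin n → A) (y : Fin n → B), (∏ l, μ (x l, y l)) *
      ((∑ i ∈ s, a i * f i x) * ∑ j ∈ t, b j * g j y) =
      ∑ i ∈ s, ∑ j ∈ t, a i * b j * ((∏ l, μ (x l, y l)) * (f i x * g j y)) := fun x y => by
    rw [Finset.sum_mul_sum, Finset.mul_sum]
    refine Finset.sum_congr rfl fun i _ => ?_
    rw [Finset.mul_sum]
    exact Finset.sum_congr rfl fun j _ => by ring
  have h' : ∀ x : Fin n → A, (∑ y : Fin n → B, ∑ i ∈ s, ∑ j ∈ t,
      a i * b j * ((∏ l, μ (x l, y l)) * (f i x * g j y))) =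
      ∑ i ∈ s, ∑ j ∈ t, ∑ y : Fin n → B,
        a i * b j * ((∏ l, μ (x l, y l)) * (f i x * g j y)) := fun x => by
    rw [Finset.sum_comm]
    exact Finset.sum_congr rfl fun i _ => Finset.sum_comm
  simp only [prodCorr, h, h']
  simp only [Finset.mul_sum]
  rw [Finset.sum_comm]
  exact Finset.sum_congr rfl fun i _ => Finset.sum_comm

/-- The tensor product of the kernels `k i`, acting on functions on `A^n`. -/
def tensorOp (k : Fin n → A → A → ℝ) (f : (Fin n → A) → ℝ) : (Fin n → A) → ℝ :=
  fun x => ∑ z, (∏ i, k i (x i) (z i)) * f z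

lemma tensorOp_tensorOp (k l : Fin n → A → A → ℝ) (f : (Fin n → A) → ℝ) :
    tensorOp k (tensorOp l f) = tensorOp (fun i a c => ∑ b, k i a b * l i b c) f := by
  funext x
  simp only [tensorOp, Finset.mul_sum, Finset.prod_univ_sum, Fintype.piFinset_univ, Finset.sum_mul]
  rw [Finset.sum_comm]
  simp only [Finset.prod_mul_distrib, mul_assoc]

lemma tensorOp_eq_zero {k : Fin n → A → A → ℝ} {i : Fin n} (h : k i = 0)
    (f : (Fin n → A) → ℝ) : tensorOp k f = 0 := by
  funext x
  refine Finset.sum_eq_zero fun z _ => ?_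
  rw [Finset.prod_eq_zero (Finset.mem_univ i) (by simp [h]), zero_mul]

lemma prodCorr_tensorOp_left {μ : A × B → ℝ} {k : Fin n → A → A → ℝ} {l : Fin n → B → B → ℝ}
    (h : ∀ i z b, ∑ a, μ (a, b) * k i a z = ∑ b', μ (z, b') * l i b' b)
    (f : (Fin n → A) → ℝ) (g : (Fin n → B) → ℝ) :
    prodCorr μ (tensorOp k f) g = prodCorr μ f (tensorOp l g) := by
  have hl : prodCorr μ (tensorOp k f) g =
      ∑ z, ∑ y, (∏ i, ∑ a, μ (a, y i) * k i a (z i)) * (f z * g y) := by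
    simp only [prodCorr, tensorOp, Finset.mul_sum, Finset.prod_univ_sum, Fintype.piFinset_univ,
      Finset.sum_mul]
    rw [Finset.sum_comm]
    rw [Finset.sum_congr rfl fun y _ => Finset.sum_comm, Finset.sum_comm]
    refine Finset.sum_congr rfl fun z _ => Finset.sum_congr rfl fun y _ =>
      Finset.sum_congr rfl fun x _ => ?_
    rw [Finset.prod_mul_distrib]; ring
  have hr : prodCorr μ f (tensorOp l g) =
      ∑ z, ∑ y, (∏ i, ∑ b, μ (z i, b) * l i b (y i)) * (f z * g y) := by
    simp only [prodCorr, tensorOp, Finset.mul_sum, Finset.prod_univ_sum, Fintype.piFinset_univ,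
      Finset.sum_mul]
    refine Finset.sum_congr rfl fun z _ => ?_
    rw [Finset.sum_comm]
    refine Finset.sum_congr rfl fun y _ => Finset.sum_congr rfl fun x _ => ?_
    rw [Finset.prod_mul_distrib]; ring
  rw [hl, hr]
  simp only [h]

/-- The kernels of the projection onto the Efron–Stein component indexed by `S`. -/
def efronSteinKernel (p : A → ℝ) (S : Finset (Fin n)) (i : Fin n) (a z : A) : ℝ :=
  if i ∈ S then (if a = z then 1 else 0) - p z else p z

/-- The Efron–Stein component of `f` indexed by `S`. -/
def efronStein (p : A → ℝ) (S : Finset (Fin n)) (f : (Fin n → A) → ℝ) : (Fin n → A) → ℝ :=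
  tensorOp (efronSteinKernel p S) f

/-- The kernel which keeps a coordinate with probability `s` and resamples it otherwise. -/
def noiseKernel (p : A → ℝ) (s : ℝ) (a z : A) : ℝ :=
  s * (if a = z then 1 else 0) + (1 - s) * p z

/-- The noise operator `T_s`. -/
def noiseOp (p : A → ℝ) (s : ℝ) (f : (Fin n → A) → ℝ) : (Fin n → A) → ℝ :=
  tensorOp (fun _ => noiseKernel p s) f

lemma noiseOp_eq_sum (p : A → ℝ) (s : ℝ) (f : (Fin n → A) → ℝ) :
    noiseOp p s f = fun x => ∑ S, s ^ #S * efronStein p S f x := by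
  funext x
  simp only [noiseOp, efronStein, tensorOp, Finset.mul_sum]
  rw [Finset.sum_comm]
  refine Finset.sum_congr rfl fun z _ => ?_
  have h : ∀ i, noiseKernel p s (x i) (z i) =
      s * ((if x i = z i then 1 else 0) - p (z i)) + p (z i) := fun i => by
    unfold noiseKernel; ring
  simp only [h]
  rw [Finset.prod_add, Finset.sum_mul, Finset.powerset_univ]
  refine Finset.sum_congr rfl fun S _ => ?_
  rw [← mul_assoc]
  congr 1
  rw [Finset.prod_mul_distrib, Finset.prod_const, mul_assoc]
  congr 1
  simp only [efronSteinKernel]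
  rw [Finset.prod_ite]
  congr 1
  · simp
  · refine Finset.prod_congr ?_ fun _ _ => rfl
    ext i; simp

lemma noiseOp_one (p : A → ℝ) (f : (Fin n → A) → ℝ) : noiseOp p 1 f = f := by
  funext x
  simp only [noiseOp, tensorOp, noiseKernel]
  rw [Finset.sum_eq_single x]
  · simp
  · intro y _ hxy
    obtain ⟨i, hi⟩ : ∃ i, x i ≠ y i := by
      by_contra! h
      exact hxy (funext fun i => (h i).symm)
    rw [Finset.prod_eq_zero (Finset.mem_univ i) (by simp [hi]), zero_mul]
  · simp

lemma noiseOp_mem_Icc {p : A → ℝ} (hp : IsDist p) {s : ℝ} (hs0 : 0 ≤ s) (hs1 : s ≤ 1)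
    {f : (Fin n → A) → ℝ} (hf : ∀ x, f x ∈ Set.Icc (-1 : ℝ) 1) (x : Fin n → A) :
    noiseOp p s f x ∈ Set.Icc (-1 : ℝ) 1 := by
  have h0 : ∀ z : Fin n → A, 0 ≤ ∏ i, noiseKernel p s (x i) (z i) := fun z =>
    Finset.prod_nonneg fun i _ => add_nonneg (mul_nonneg hs0 (by split_ifs <;> norm_num))
      (mul_nonneg (by linarith) (hp.1 _))
  have h1 : ∑ z : Fin n → A, ∏ i, noiseKernel p s (x i) (z i) = 1 := by
    have := Finset.prod_univ_sum (fun _ : Fin n => (Finset.univ : Finset A))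
      (fun i a => noiseKernel p s (x i) a)
    rw [Fintype.piFinset_univ] at this
    rw [← this]
    refine Finset.prod_eq_one fun i _ => ?_
    simp [noiseKernel, Finset.sum_add_distrib, ← Finset.mul_sum, hp.2]
  constructor
  · rw [← h1, ← Finset.sum_neg_distrib]
    refine Finset.sum_le_sum fun z _ => ?_
    nlinarith [h0 z, (hf z).1]
  · rw [← h1]
    refine Finset.sum_le_sum fun z _ => ?_
    nlinarith [h0 z, (hf z).2]

lemma pmean_noiseOp {p : A → ℝ} (hp : IsDist p) (s : ℝ) (f : (Fin n → A) → ℝ) :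
    pmean (prodDist p n) (noiseOp p s f) = pmean (prodDist p n) f := by
  simp only [pmean, noiseOp, tensorOp, prodDist, Finset.mul_sum]
  rw [Finset.sum_comm]
  refine Finset.sum_congr rfl fun z _ => ?_
  have := Finset.prod_univ_sum (fun _ : Fin n => (Finset.univ : Finset A))
    (fun i a => p a * noiseKernel p s a (z i))
  rw [Fintype.piFinset_univ] at this
  simp only [← mul_assoc, ← Finset.sum_mul, ← Finset.prod_mul_distrib]
  rw [← this]
  congr 1
  refine Finset.prod_congr rfl fun i _ => ?_
  simp only [noiseKernel, mul_add, Finset.sum_add_distrib]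
  rw [← Finset.sum_mul, hp.2]
  simp
  ring

lemma efronStein_dependsOnLE (p : A → ℝ) (S : Finset (Fin n)) (f : (Fin n → A) → ℝ) :
    DependsOnLE #S (efronStein p S f) := by
  refine ⟨S, le_rfl, fun x y hxy => Finset.sum_congr rfl fun z _ => ?_⟩
  congr 1
  refine Finset.prod_congr rfl fun i _ => ?_
  by_cases hi : i ∈ S <;> simp [efronSteinKernel, hi, hxy]

lemma efronStein_average {p : A → ℝ} (hp : IsDist p) {S : Finset (Fin n)} {i : Fin n}
    (hi : i ∈ S) (f : (Fin n → A) → ℝ) (x : Fin n → A) :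
    ∑ a, p a * efronStein p S f (Function.update x i a) = 0 := by
  simp only [efronStein, tensorOp, Finset.mul_sum]
  rw [Finset.sum_comm]
  refine Finset.sum_eq_zero fun z _ => ?_
  have h : ∀ a, ∏ j, efronSteinKernel p S j (Function.update x i a j) (z j) =
      efronSteinKernel p S i a (z i) *
        ∏ j ∈ Finset.univ.erase i, efronSteinKernel p S j (x j) (z j) := fun a => by
    rw [← Finset.mul_prod_erase _ _ (Finset.mem_univ i)]
    simp only [Function.update_self]
    congr 1
    refine Finset.prod_congr rfl fun j hj => ?_
    rw [Function.update_of_ne (Finset.ne_of_mem_erase hj)]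
  have h0 : ∑ a, p a * efronSteinKernel p S i a (z i) = 0 := by
    simp [efronSteinKernel, hi, mul_sub, Finset.sum_sub_distrib, ← Finset.sum_mul, hp.2]
  simp only [h]
  simp only [← mul_assoc, ← Finset.sum_mul, h0, zero_mul]

lemma prodCorr_efronStein_of_ne {μ : A × B → ℝ} (hq : IsDist (marginalB μ))
    {S S' : Finset (Fin n)} (hS : S ≠ S') (f : (Fin n → A) → ℝ) (g : (Fin n → B) → ℝ) :
    prodCorr μ (efronStein (marginalA μ) S f) (efronStein (marginalB μ) S' g) = 0 := by
  have hadj : ∀ i z b, ∑ a, μ (a, b) * efronSteinKernel (marginalA μ) S i a z =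
      ∑ b', μ (z, b') * efronSteinKernel (marginalB μ) S i b' b := fun i z b => by
    by_cases hi : i ∈ S <;>
      simp [efronSteinKernel, hi, mul_sub, Finset.sum_sub_distrib, ← Finset.sum_mul,
        marginalA, marginalB, mul_comm]
  obtain ⟨i, hi⟩ : ∃ i, ¬ (i ∈ S ↔ i ∈ S') := by
    by_contra! h
    exact hS (Finset.ext h)
  have hker : (fun a c => ∑ b, efronSteinKernel (marginalB μ) S i a b *
      efronSteinKernel (marginalB μ) S' i b c) = 0 := by
    funext a c
    by_cases h : i ∈ S <;> by_cases h' : i ∈ S' <;> simp only [h, h'] at hi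
    · simp at hi
    · simp [efronSteinKernel, h, h', sub_mul, Finset.sum_sub_distrib, ← Finset.sum_mul, hq.2]
    · simp [efronSteinKernel, h, h', mul_sub, Finset.sum_sub_distrib, ← Finset.sum_mul, hq.2]
    · simp at hi
  unfold efronStein
  rw [prodCorr_tensorOp_left hadj, tensorOp_tensorOp, tensorOp_eq_zero (i := i) hker]
  simp [prodCorr]

lemma prodCorr_sum_efronStein {μ : A × B → ℝ} (hq : IsDist (marginalB μ))
    (F : Finset (Finset (Fin n))) (c c' : Finset (Fin n) → ℝ)
    (f : (Fin n → A) → ℝ) (g : (Fin n → B) → ℝ) :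
    prodCorr μ (fun x => ∑ S ∈ F, c S * efronStein (marginalA μ) S f x)
      (fun y => ∑ S ∈ F, c' S * efronStein (marginalB μ) S g y) =
    ∑ S ∈ F, c S * c' S *
      prodCorr μ (efronStein (marginalA μ) S f) (efronStein (marginalB μ) S g) := by
  rw [prodCorr_sum_sum]
  refine Finset.sum_congr rfl fun S hS => ?_
  rw [Finset.sum_eq_single_of_mem S hS]
  intro S' _ hne
  rw [prodCorr_efronStein_of_ne hq hne.symm, mul_zero]

lemma normSqL2_sum_efronStein {p : A → ℝ} (hp : IsDist p) (F : Finset (Finset (Fin n)))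
    (c : Finset (Fin n) → ℝ) (f : (Fin n → A) → ℝ) :
    normSqL2 p (fun x => ∑ S ∈ F, c S * efronStein p S f x) =
      ∑ S ∈ F, c S ^ 2 * normSqL2 p (efronStein p S f) := by
  have h := prodCorr_sum_efronStein (μ := diagDist p) (by simpa using hp) F c c f f
  simp only [marginalA_diagDist, marginalB_diagDist, prodCorr_diagDist_self] at h
  simpa only [sq] using h

lemma prodCorr_noiseOp {μ : A × B → ℝ} (hq : IsDist (marginalB μ)) (s : ℝ)
    (f : (Fin n → A) → ℝ) (g : (Fin n → B) → ℝ) :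
    prodCorr μ (noiseOp (marginalA μ) s f) (noiseOp (marginalB μ) s g) =
      ∑ S, s ^ #S * s ^ #S *
        prodCorr μ (efronStein (marginalA μ) S f) (efronStein (marginalB μ) S g) := by
  simp only [noiseOp_eq_sum]
  exact prodCorr_sum_efronStein hq _ _ _ f g

lemma sum_normSqL2_efronStein {p : A → ℝ} (hp : IsDist p) (f : (Fin n → A) → ℝ) :
    ∑ S, normSqL2 p (efronStein p S f) = normSqL2 p f := by
  have h := normSqL2_sum_efronStein hp Finset.univ (fun S => 1 ^ #S) f
  rw [← noiseOp_eq_sum, noiseOp_one] at h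
  simpa using h.symm

lemma normSqL2_le_one {p : A → ℝ} (hp : IsDist p) {f : (Fin n → A) → ℝ}
    (hf : ∀ x, f x ∈ Set.Icc (-1 : ℝ) 1) : normSqL2 p f ≤ 1 := by
  have h1 : ∑ x : Fin n → A, prodDist p n x = 1 := by
    have := Finset.prod_univ_sum (fun _ : Fin n => (Finset.univ : Finset A)) (fun _ a => p a)
    rw [Fintype.piFinset_univ] at this
    simp only [prodDist, ← this, hp.2, Finset.prod_const_one]
  rw [← h1]
  refine Finset.sum_le_sum fun x _ => mul_le_of_le_one_right
    (Finset.prod_nonneg fun i _ => hp.1 (x i)) ?_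
  rw [sq_le_one_iff_abs_le_one, abs_le]
  exact hf x

lemma noiseOp_low_degree_approx {p : A → ℝ} (hp : IsDist p) {s η : ℝ} (hs0 : 0 ≤ s)
    (hs1 : s ≤ 1) {d : ℕ} (hd : s ^ d ≤ η) {f : (Fin n → A) → ℝ}
    (hf : ∀ x, f x ∈ Set.Icc (-1 : ℝ) 1) :
    ∃ fLow : (Fin n → A) → ℝ, degLE d fLow ∧
      pmean (prodDist p n) (fun x => (noiseOp p s f x - fLow x) ^ 2) ≤ η := by
  refine ⟨fun x => ∑ S with #S ≤ d, s ^ #S * efronStein p S f x, ?_, ?_⟩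
  · have : (fun x => ∑ S with #S ≤ d, s ^ #S * efronStein p S f x) =
        ∑ S : Finset (Fin n) with #S ≤ d, s ^ #S • efronStein p S f := by
      funext x; simp
    rw [this]
    refine Submodule.sum_mem _ fun S hS => Submodule.smul_mem _ _ (Submodule.subset_span ?_)
    obtain ⟨J, hJ, h⟩ := efronStein_dependsOnLE p S f
    exact ⟨J, hJ.trans (Finset.mem_filter.1 hS).2, h⟩
  · have h : (fun x => noiseOp p s f x - ∑ S with #S ≤ d, s ^ #S * efronStein p S f x) =
        fun x => ∑ S with ¬ #S ≤ d, s ^ #S * efronStein p S f x := by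
      funext x
      rw [noiseOp_eq_sum, sub_eq_iff_eq_add']
      exact (Finset.sum_filter_add_sum_filter_not Finset.univ (fun S => #S ≤ d) fun S =>
        s ^ #S * efronStein p S f x).symm
    change normSqL2 p (fun x => noiseOp p s f x - _) ≤ η
    rw [h, normSqL2_sum_efronStein hp]
    calc _ ≤ ∑ S : Finset (Fin n) with ¬ #S ≤ d, s ^ d * normSqL2 p (efronStein p S f) := by
          refine Finset.sum_le_sum fun S hS => mul_le_mul_of_nonneg_right ?_
            (normSqL2_nonneg hp.1 _)
          rw [← pow_mul]
          refine pow_le_pow_of_le_one hs0 hs1 ?_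
          have := (Finset.mem_filter.1 hS).2
          omega
      _ ≤ ∑ S : Finset (Fin n), s ^ d * normSqL2 p (efronStein p S f) :=
          Finset.sum_le_sum_of_subset_of_nonneg (Finset.filter_subset _ _) fun S _ _ =>
            mul_nonneg (pow_nonneg hs0 d) (normSqL2_nonneg hp.1 _)
      _ = s ^ d * normSqL2 p f := by rw [← Finset.mul_sum, sum_normSqL2_efronStein hp]
      _ ≤ s ^ d := mul_le_of_le_one_right (pow_nonneg hs0 d) (normSqL2_le_one hp hf)
      _ ≤ η := hd

end Product

section MaximalCorrelation

variable {A B : Type*} [Fintype A] [Fintype B]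

lemma IsDist.marginalA {μ : A × B → ℝ} (hμ : IsDist μ) : IsDist (marginalA μ) :=
  ⟨fun a => Finset.sum_nonneg fun b _ => hμ.1 (a, b), by
    rw [← hμ.2, Fintype.sum_prod_type]; rfl⟩

lemma IsDist.marginalB {μ : A × B → ℝ} (hμ : IsDist μ) : IsDist (marginalB μ) :=
  ⟨fun b => Finset.sum_nonneg fun a _ => hμ.1 (a, b), by
    rw [← hμ.2, Fintype.sum_prod_type_right]; rfl⟩

lemma pmean_fst (μ : A × B → ℝ) (f : A → ℝ) :
    pmean μ (fun ab => f ab.1) = pmean (marginalA μ) f := by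
  simp [pmean, marginalA, Fintype.sum_prod_type, Finset.sum_mul]

lemma pmean_snd (μ : A × B → ℝ) (g : B → ℝ) :
    pmean μ (fun ab => g ab.2) = pmean (marginalB μ) g := by
  simp [pmean, marginalB, Fintype.sum_prod_type_right, Finset.sum_mul]

lemma pmean_const_mul (p : A → ℝ) (c : ℝ) (f : A → ℝ) :
    pmean p (fun a => c * f a) = c * pmean p f := by
  simp only [pmean, Finset.mul_sum, mul_left_comm]

lemma pmean_sq_nonneg {p : A → ℝ} (hp : ∀ a, 0 ≤ p a) (f : A → ℝ) :
    0 ≤ pmean p (fun a => f a ^ 2) :=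
  Finset.sum_nonneg fun a _ => mul_nonneg (hp a) (sq_nonneg _)

lemma pmean_mul_le_sqrt {p : A → ℝ} (hp : ∀ a, 0 ≤ p a) (f g : A → ℝ) :
    pmean p (fun a => f a * g a) ≤
      √(pmean p fun a => f a ^ 2) * √(pmean p fun a => g a ^ 2) := by
  refine le_trans (Finset.sum_le_sum fun a _ => ?_) (Real.sum_sqrt_mul_sqrt_le
    (f := fun a => p a * f a ^ 2) (g := fun a => p a * g a ^ 2) Finset.univ
    (fun a => mul_nonneg (hp a) (sq_nonneg (f a))) (fun a => mul_nonneg (hp a) (sq_nonneg (g a))))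
  rw [← Real.sqrt_mul (mul_nonneg (hp a) (sq_nonneg (f a)))]
  refine Real.le_sqrt_of_sq_le (le_of_eq ?_)
  ring

lemma pmean_pair_mul_le_sqrt {μ : A × B → ℝ} (hμ : IsDist μ) (f : A → ℝ) (g : B → ℝ) :
    pmean μ (fun ab => f ab.1 * g ab.2) ≤
      √(pmean (marginalA μ) fun a => f a ^ 2) * √(pmean (marginalB μ) fun b => g b ^ 2) := by
  have h := pmean_mul_le_sqrt hμ.1 (fun ab => f ab.1) (fun ab => g ab.2)
  rwa [pmean_fst μ (fun a => f a ^ 2), pmean_snd μ (fun b => g b ^ 2)] at h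

lemma pmean_pair_mul_le_maxCorr {μ : A × B → ℝ} (hμ : IsDist μ) {f : A → ℝ} {g : B → ℝ}
    (hf : pmean (marginalA μ) f = 0) (hg : pmean (marginalB μ) g = 0) :
    pmean μ (fun ab => f ab.1 * g ab.2) ≤ maxCorr μ *
      (√(pmean (marginalA μ) fun a => f a ^ 2) * √(pmean (marginalB μ) fun b => g b ^ 2)) := by
  have hcs := pmean_pair_mul_le_sqrt hμ f g
  set u := √(pmean (marginalA μ) fun a => f a ^ 2) with hu
  set v := √(pmean (marginalB μ) fun b => g b ^ 2) with hv
  have hu2 : u ^ 2 = pmean (marginalA μ) fun a => f a ^ 2 :=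
    Real.sq_sqrt (pmean_sq_nonneg hμ.marginalA.1 f)
  have hv2 : v ^ 2 = pmean (marginalB μ) fun b => g b ^ 2 :=
    Real.sq_sqrt (pmean_sq_nonneg hμ.marginalB.1 g)
  rcases eq_or_ne (u * v) 0 with h0 | h0
  · rw [h0, mul_zero]; rwa [h0] at hcs
  have hu0 : u ≠ 0 := left_ne_zero_of_mul h0
  have hv0 : v ≠ 0 := right_ne_zero_of_mul h0
  have hupos : 0 < u := (Real.sqrt_nonneg _).lt_of_ne' hu0
  have hvpos : 0 < v := (Real.sqrt_nonneg _).lt_of_ne' hv0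
  have hmem : u⁻¹ * v⁻¹ * pmean μ (fun ab => f ab.1 * g ab.2) ≤ maxCorr μ := by
    refine le_csSup ⟨1, ?_⟩ ⟨fun a => u⁻¹ * f a, fun b => v⁻¹ * g b, ?_, ?_, ?_, ?_, ?_⟩
    · rintro r ⟨f', g', hf', hg', hvf, hvg, rfl⟩
      simp only [pvar, hf', hg', sub_zero] at hvf hvg
      simpa [hvf, hvg] using pmean_pair_mul_le_sqrt hμ f' g'
    · rw [pmean_const_mul, hf, mul_zero]
    · rw [pmean_const_mul, hg, mul_zero]
    · simp only [pvar, pmean_const_mul, hf, mul_zero, sub_zero, mul_pow]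
      rw [← hu2, ← mul_pow, inv_mul_cancel₀ hu0, one_pow]
    · simp only [pvar, pmean_const_mul, hg, mul_zero, sub_zero, mul_pow]
      rw [← hv2, ← mul_pow, inv_mul_cancel₀ hv0, one_pow]
    · rw [← pmean_const_mul]
      congr 1
      funext ab
      ring
  calc _ = u⁻¹ * v⁻¹ * pmean μ (fun ab => f ab.1 * g ab.2) * (u * v) := by field_simp
    _ ≤ _ := mul_le_mul_of_nonneg_right hmem (by positivity)

/-- The conditional expectation of `g(b)` given `a` under `μ`. -/
def condMean (μ : A × B → ℝ) (g : B → ℝ) (a : A) : ℝ := (∑ b, μ (a, b) * g b) / marginalA μ a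

lemma marginalA_mul_condMean {μ : A × B → ℝ} (hμ : IsDist μ) (g : B → ℝ) (a : A) :
    marginalA μ a * condMean μ g a = ∑ b, μ (a, b) * g b := by
  by_cases h : marginalA μ a = 0
  · have h' : ∀ b, μ (a, b) = 0 := fun b =>
      (Finset.sum_eq_zero_iff_of_nonneg fun b _ => hμ.1 (a, b)).1 h b (Finset.mem_univ b)
    simp [h, h']
  · rw [condMean, mul_div_cancel₀ _ h]

lemma pmean_condMean {μ : A × B → ℝ} (hμ : IsDist μ) (f : A → ℝ) (g : B → ℝ) :
    pmean (marginalA μ) (fun a => f a * condMean μ g a) = pmean μ (fun ab => f ab.1 * g ab.2) := by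
  simp only [pmean, Fintype.sum_prod_type]
  refine Finset.sum_congr rfl fun a _ => ?_
  rw [mul_left_comm, marginalA_mul_condMean hμ, Finset.mul_sum]
  exact Finset.sum_congr rfl fun b _ => by ring

lemma pmean_condMean_sq_le {μ : A × B → ℝ} (hμ : IsDist μ) {c : ℝ} {g : B → ℝ}
    (h : ∀ f : A → ℝ, pmean (marginalA μ) f = pmean (marginalB μ) g →
      pmean μ (fun ab => f ab.1 * g ab.2) ≤ c *
      (√(pmean (marginalA μ) fun a => f a ^ 2) * √(pmean (marginalB μ) fun b => g b ^ 2))) :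
    pmean (marginalA μ) (fun a => condMean μ g a ^ 2) ≤
      c ^ 2 * pmean (marginalB μ) (fun b => g b ^ 2) := by
  have hmean : pmean (marginalA μ) (condMean μ g) = pmean (marginalB μ) g := by
    have := pmean_condMean hμ (fun _ => 1) g
    simpa [pmean_snd μ g] using this
  have hle := h _ hmean
  rw [← pmean_condMean hμ] at hle
  simp only [← sq] at hle
  have hP := pmean_sq_nonneg hμ.marginalA.1 (condMean μ g)
  have hQ := pmean_sq_nonneg hμ.marginalB.1 g
  set P := pmean (marginalA μ) (fun a => condMean μ g a ^ 2)
  set Q := pmean (marginalB μ) (fun b => g b ^ 2)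
  rcases hP.eq_or_lt with h0 | h0
  · rw [← h0]; positivity
  have h1 : 0 < √P := Real.sqrt_pos.2 h0
  have h2 : √P ≤ c * √Q := by
    refine le_of_mul_le_mul_left ?_ h1
    calc √P * √P = P := Real.mul_self_sqrt hP
      _ ≤ c * (√P * √Q) := hle
      _ = _ := by ring
  calc P = √P ^ 2 := (Real.sq_sqrt hP).symm
    _ ≤ (c * √Q) ^ 2 := pow_le_pow_left₀ h1.le h2 2
    _ = _ := by rw [mul_pow, Real.sq_sqrt hQ]

lemma sum_fin_succ_fun {n : ℕ} (F : (Fin (n + 1) → A) → ℝ) :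
    ∑ x, F x = ∑ a, ∑ x : Fin n → A, F (Fin.cons a x) := by
  rw [← (Fin.consEquiv fun _ => A).sum_comp, Fintype.sum_prod_type]
  rfl

lemma normSqL2_succ {n : ℕ} (p : A → ℝ) (f : (Fin (n + 1) → A) → ℝ) :
    normSqL2 p f = pmean p (fun a => normSqL2 p fun x : Fin n → A => f (Fin.cons a x)) := by
  simp only [normSqL2, pmean, prodDist, sum_fin_succ_fun, Finset.mul_sum]
  simp [Fin.prod_univ_succ, mul_assoc]

lemma prodCorr_succ {n : ℕ} {μ : A × B → ℝ} (hμ : IsDist μ) (f : (Fin (n + 1) → A) → ℝ)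
    (g : (Fin (n + 1) → B) → ℝ) :
    prodCorr μ f g = pmean (marginalA μ) (fun a => prodCorr μ (fun x => f (Fin.cons a x))
      (fun y => condMean μ (fun b => g (Fin.cons b y)) a)) := by
  simp only [prodCorr, pmean, sum_fin_succ_fun, Finset.mul_sum]
  refine Finset.sum_congr rfl fun a _ => Finset.sum_congr rfl fun x _ => ?_
  rw [Finset.sum_comm]
  refine Finset.sum_congr rfl fun y _ => ?_
  calc _ = (∏ i, μ (x i, y i)) * f (Fin.cons a x) * ∑ b, μ (a, b) * g (Fin.cons b y) := by
        rw [Finset.mul_sum]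
        refine Finset.sum_congr rfl fun b _ => ?_
        rw [Fin.prod_univ_succ]
        simp only [Fin.cons_zero, Fin.cons_succ]
        ring
    _ = _ := by rw [← marginalA_mul_condMean hμ]; ring

/-- Tensorization of the maximal correlation: functions averaging to zero in each coordinate of
`S` have correlation at most `r ^ #S`, where `r` bounds the maximal correlation. -/
lemma prodCorr_le_of_average_eq_zero {μ : A × B → ℝ} (hμ : IsDist μ) {r : ℝ} (hr0 : 0 ≤ r)
    (hr : maxCorr μ ≤ r) {n : ℕ} (S : Finset (Fin n)) (f : (Fin n → A) → ℝ)
    (g : (Fin n → B) → ℝ)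
    (hf : ∀ i ∈ S, ∀ x, ∑ a, marginalA μ a * f (Function.update x i a) = 0)
    (hg : ∀ i ∈ S, ∀ y, ∑ b, marginalB μ b * g (Function.update y i b) = 0) :
    prodCorr μ f g ≤ (∏ i, if i ∈ S then r else 1) *
      (√(normSqL2 (marginalA μ) f) * √(normSqL2 (marginalB μ) g)) := by
  induction n with
  | zero =>
    simp only [prodCorr, normSqL2, pmean, prodDist, Finset.univ_unique, Finset.sum_singleton,
      Finset.univ_eq_empty, Finset.prod_empty, one_mul, Real.sqrt_sq_eq_abs]
    rw [← abs_mul]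
    exact le_abs_self _
  | succ n ih =>
    have hA := hμ.marginalA
    have hB := hμ.marginalB
    set c : ℝ := if 0 ∈ S then r else 1 with hc
    have hc0 : 0 ≤ c := by rw [hc]; split_ifs <;> positivity
    set S' : Finset (Fin n) := Finset.univ.filter fun i => i.succ ∈ S with hS'
    set C : ℝ := ∏ i : Fin n, if i ∈ S' then r else 1 with hC
    have hC0 : 0 ≤ C := Finset.prod_nonneg fun i _ => by split_ifs <;> positivity
    have hprod : (∏ i : Fin (n + 1), if i ∈ S then r else 1) = c * C := by
      rw [Fin.prod_univ_succ]; simp [hc, hC, hS']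
    set G : A → (Fin n → B) → ℝ := fun a y => condMean μ (fun b => g (Fin.cons b y)) a with hG
    have hslice : ∀ a, prodCorr μ (fun x => f (Fin.cons a x)) (G a) ≤
        C * (√(normSqL2 (marginalA μ) fun x : Fin n → A => f (Fin.cons a x)) *
          √(normSqL2 (marginalB μ) (G a))) := fun a => by
      refine ih S' _ _ (fun i hi x => ?_) (fun i hi y => ?_)
      · have := hf i.succ (by simpa [hS'] using hi) (Fin.cons a x)
        simpa only [Fin.cons_update] using this
      · have : ∀ b', ∑ b, marginalB μ b * g (Fin.cons b' (Function.update y i b)) = 0 :=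
          fun b' => by
            have := hg i.succ (by simpa [hS'] using hi) (Fin.cons b' y)
            simpa only [Fin.cons_update] using this
        simp only [hG, condMean, ← mul_div_assoc, ← Finset.sum_div]
        simp only [Finset.mul_sum]
        rw [Finset.sum_comm]
        simp only [mul_left_comm (marginalB μ _), ← Finset.mul_sum, this]
        simp
    have hGnorm : pmean (marginalA μ) (fun a => normSqL2 (marginalB μ) (G a)) ≤
        c ^ 2 * normSqL2 (marginalB μ) g := by
      have h1 : pmean (marginalA μ) (fun a => normSqL2 (marginalB μ) (G a)) =
          ∑ y, prodDist (marginalB μ) n y * pmean (marginalA μ) (fun a => G a y ^ 2) := by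
        simp only [pmean, normSqL2, Finset.mul_sum]
        rw [Finset.sum_comm]
        simp only [mul_left_comm]
      have h2 : c ^ 2 * normSqL2 (marginalB μ) g = ∑ y, prodDist (marginalB μ) n y *
          (c ^ 2 * pmean (marginalB μ) (fun b => g (Fin.cons b y) ^ 2)) := by
        rw [normSqL2_succ]
        simp only [pmean, normSqL2, Finset.mul_sum]
        rw [Finset.sum_comm]
        refine Finset.sum_congr rfl fun y _ => Finset.sum_congr rfl fun b _ => ?_
        ring
      rw [h1, h2]
      refine Finset.sum_le_sum fun y _ => mul_le_mul_of_nonneg_left ?_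
        (Finset.prod_nonneg fun i _ => hB.1 (y i))
      refine pmean_condMean_sq_le hμ fun f' hf' => ?_
      by_cases h0 : 0 ∈ S
      · have hgy : pmean (marginalB μ) (fun b => g (Fin.cons b y)) = 0 := by
          rcases isEmpty_or_nonempty B with hE | ⟨⟨b₀⟩⟩
          · simp [pmean]
          · have := hg 0 h0 (Fin.cons b₀ y)
            simp only [Fin.update_cons_zero] at this
            exact this
        refine (pmean_pair_mul_le_maxCorr hμ (hf'.trans hgy) hgy).trans
          (mul_le_mul_of_nonneg_right ?_ (by positivity))
        simpa [hc, h0] using hr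
      · simpa [hc, h0] using pmean_pair_mul_le_sqrt hμ f' (fun b => g (Fin.cons b y))
    have hnn : ∀ a, 0 ≤ normSqL2 (marginalA μ) fun x : Fin n → A => f (Fin.cons a x) :=
      fun a => normSqL2_nonneg hA.1 _
    have hnG : ∀ a, 0 ≤ normSqL2 (marginalB μ) (G a) := fun a => normSqL2_nonneg hB.1 _
    have hcs := pmean_mul_le_sqrt hA.1
      (fun a => √(normSqL2 (marginalA μ) fun x : Fin n → A => f (Fin.cons a x)))
      (fun a => √(normSqL2 (marginalB μ) (G a)))
    simp only [Real.sq_sqrt (hnn _), Real.sq_sqrt (hnG _), ← normSqL2_succ] at hcs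
    calc prodCorr μ f g
        = pmean (marginalA μ) (fun a => prodCorr μ (fun x => f (Fin.cons a x)) (G a)) :=
          prodCorr_succ hμ f g
      _ ≤ C * pmean (marginalA μ) (fun a =>
            √(normSqL2 (marginalA μ) fun x : Fin n → A => f (Fin.cons a x)) *
            √(normSqL2 (marginalB μ) (G a))) := by
          simp only [pmean, Finset.mul_sum]
          refine Finset.sum_le_sum fun a _ => ?_
          rw [mul_left_comm]
          exact mul_le_mul_of_nonneg_left (hslice a) (hA.1 a)
      _ ≤ C * (√(normSqL2 (marginalA μ) f) * √(c ^ 2 * normSqL2 (marginalB μ) g)) := by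
          refine mul_le_mul_of_nonneg_left (hcs.trans ?_) hC0
          exact mul_le_mul_of_nonneg_left (Real.sqrt_le_sqrt hGnorm) (Real.sqrt_nonneg _)
      _ = _ := by
          rw [hprod, Real.sqrt_mul (sq_nonneg c), Real.sqrt_sq hc0]; ring

lemma prodCorr_neg_left {n : ℕ} (μ : A × B → ℝ) (f : (Fin n → A) → ℝ) (g : (Fin n → B) → ℝ) :
    prodCorr μ (fun x => -f x) g = -prodCorr μ f g := by
  simp [prodCorr]

lemma abs_prodCorr_efronStein_le {μ : A × B → ℝ} (hμ : IsDist μ) {r : ℝ} (hr0 : 0 ≤ r)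
    (hr : maxCorr μ ≤ r) {n : ℕ} (S : Finset (Fin n)) (f : (Fin n → A) → ℝ)
    (g : (Fin n → B) → ℝ) :
    |prodCorr μ (efronStein (marginalA μ) S f) (efronStein (marginalB μ) S g)| ≤
      r ^ #S * ((normSqL2 (marginalA μ) (efronStein (marginalA μ) S f) +
        normSqL2 (marginalB μ) (efronStein (marginalB μ) S g)) / 2) := by
  have hA := hμ.marginalA
  have hB := hμ.marginalB
  have hprod : (∏ i, if i ∈ S then r else 1) = r ^ #S := by
    rw [Finset.prod_ite_mem, Finset.univ_inter, Finset.prod_const]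
  have h1 := prodCorr_le_of_average_eq_zero hμ hr0 hr S (efronStein (marginalA μ) S f)
    (efronStein (marginalB μ) S g) (fun i hi x => efronStein_average hA hi f x)
    (fun i hi y => efronStein_average hB hi g y)
  have h2 := prodCorr_le_of_average_eq_zero hμ hr0 hr S (fun x => -efronStein (marginalA μ) S f x)
    (efronStein (marginalB μ) S g)
    (fun i hi x => by
      simpa [Finset.sum_neg_distrib] using efronStein_average hA hi f x)
    (fun i hi y => efronStein_average hB hi g y)
  have hneg : normSqL2 (marginalA μ) (fun x => -efronStein (marginalA μ) S f x) =
      normSqL2 (marginalA μ) (efronStein (marginalA μ) S f) := by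
    simp [normSqL2]
  rw [hprod] at h1 h2
  rw [prodCorr_neg_left, hneg] at h2
  refine (abs_le'.2 ⟨h1, h2⟩).trans (mul_le_mul_of_nonneg_left ?_ (pow_nonneg hr0 _))
  have hP := Real.sq_sqrt (normSqL2_nonneg hA.1 (efronStein (marginalA μ) S f))
  have hQ := Real.sq_sqrt (normSqL2_nonneg hB.1 (efronStein (marginalB μ) S g))
  nlinarith [two_mul_le_add_sq (√(normSqL2 (marginalA μ) (efronStein (marginalA μ) S f)))
    (√(normSqL2 (marginalB μ) (efronStein (marginalB μ) S g)))]

lemma abs_prodCorr_noiseOp_sub_le {μ : A × B → ℝ} (hμ : IsDist μ) {r s lam : ℝ} (hr0 : 0 ≤ r)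
    (hr : maxCorr μ ≤ r) (hs0 : 0 ≤ s) (hs1 : s ≤ 1) (hlam : 0 ≤ lam)
    (hs : ∀ k : ℕ, (1 - s ^ k * s ^ k) * r ^ k ≤ lam) {n : ℕ} {f : (Fin n → A) → ℝ}
    {g : (Fin n → B) → ℝ} (hf : ∀ x, f x ∈ Set.Icc (-1 : ℝ) 1)
    (hg : ∀ y, g y ∈ Set.Icc (-1 : ℝ) 1) :
    |prodCorr μ (noiseOp (marginalA μ) s f) (noiseOp (marginalB μ) s g) - prodCorr μ f g| ≤
      lam := by
  have hA := hμ.marginalA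
  have hB := hμ.marginalB
  have hfg := prodCorr_noiseOp hB 1 f g
  rw [noiseOp_one, noiseOp_one] at hfg
  rw [hfg, prodCorr_noiseOp hB, abs_sub_comm, ← Finset.sum_sub_distrib]
  refine (Finset.abs_sum_le_sum_abs _ _).trans ?_
  calc _ ≤ ∑ S, lam * ((normSqL2 (marginalA μ) (efronStein (marginalA μ) S f) +
        normSqL2 (marginalB μ) (efronStein (marginalB μ) S g)) / 2) := by
        refine Finset.sum_le_sum fun S _ => ?_
        have hk : 0 ≤ 1 - s ^ #S * s ^ #S := by
          rw [← mul_pow]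
          exact sub_nonneg.2 (pow_le_one₀ (by positivity) (by nlinarith))
        rw [one_pow, one_mul, ← sub_mul, abs_mul, abs_of_nonneg hk]
        refine (mul_le_mul_of_nonneg_left (abs_prodCorr_efronStein_le hμ hr0 hr S f g) hk).trans ?_
        rw [← mul_assoc]
        refine mul_le_mul_of_nonneg_right (hs #S) ?_
        have := normSqL2_nonneg hA.1 (efronStein (marginalA μ) S f)
        have := normSqL2_nonneg hB.1 (efronStein (marginalB μ) S g)
        positivity
    _ = lam * ((normSqL2 (marginalA μ) f + normSqL2 (marginalB μ) g) / 2) := by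
        rw [← Finset.mul_sum, ← Finset.sum_div, Finset.sum_add_distrib,
          sum_normSqL2_efronStein hA, sum_normSqL2_efronStein hB]
    _ ≤ lam := by
        refine mul_le_of_le_one_right hlam ?_
        linarith [normSqL2_le_one hA hf, normSqL2_le_one hB hg]

end MaximalCorrelation

lemma exists_noise_rate {r lam : ℝ} (hr0 : 0 ≤ r) (hr1 : r < 1) (hlam : 0 < lam) :
    ∃ s : ℝ, 0 ≤ s ∧ s < 1 ∧ ∀ k : ℕ, (1 - s ^ k * s ^ k) * r ^ k ≤ lam := by
  obtain ⟨M, hM⟩ := (tendsto_self_mul_const_pow_of_lt_one hr0 hr1).bddAbove_range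
  have hMk : ∀ k : ℕ, (k : ℝ) * r ^ k ≤ M := fun k => hM ⟨k, rfl⟩
  have hM0 : 0 ≤ M := by simpa using hMk 0
  set γ : ℝ := min 1 (lam / (2 * (M + 1))) with hγ
  have hγ0 : 0 < γ := lt_min one_pos (by positivity)
  have hγ1 : γ ≤ 1 := min_le_left _ _
  have hγM : γ * (2 * (M + 1)) ≤ lam := (le_div_iff₀ (by positivity)).1 (min_le_right _ _)
  refine ⟨1 - γ, by linarith, by linarith, fun k => ?_⟩
  have hb := one_add_mul_le_pow (a := -γ) (by linarith) (k + k)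
  rw [pow_add, ← sub_eq_add_neg] at hb
  push_cast at hb
  have hrk : 0 ≤ r ^ k := pow_nonneg hr0 k
  calc _ ≤ (2 * k * γ) * r ^ k := mul_le_mul_of_nonneg_right (by linarith) hrk
    _ = γ * (2 * (k * r ^ k)) := by ring
    _ ≤ γ * (2 * (M + 1)) := mul_le_mul_of_nonneg_left (by linarith [hMk k]) hγ0.le
    _ ≤ lam := hγM

/-- Smoothing of strategies (Lemma 4.1): `f, g` can be replaced by `f₁, g₁` with
the same means, correlation changed by at most `λ`, and small Fourier tails: each of `f₁, g₁`
is within squared L²-distance `η` of the subspace of functions of degree at most `d`. -/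
theorem stmt3 {A B : Type*} [Fintype A] [Fintype B] (μ : A × B → ℝ) (hμ : IsDist μ)
    (hρ : maxCorr μ < 1) (lam η : ℝ) (hlam : 0 < lam) (hη : 0 < η) :
    ∃ d : ℕ, ∀ n : ℕ, ∀ f : (Fin n → A) → ℝ, ∀ g : (Fin n → B) → ℝ,
      (∀ x, f x ∈ Set.Icc (-1 : ℝ) 1) → (∀ y, g y ∈ Set.Icc (-1 : ℝ) 1) →
      ∃ f₁ : (Fin n → A) → ℝ, ∃ g₁ : (Fin n → B) → ℝ,
        (∀ x, f₁ x ∈ Set.Icc (-1 : ℝ) 1) ∧ (∀ y, g₁ y ∈ Set.Icc (-1 : ℝ) 1) ∧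
        pmean (prodDist (marginalA μ) n) f₁ = pmean (prodDist (marginalA μ) n) f ∧
        pmean (prodDist (marginalB μ) n) g₁ = pmean (prodDist (marginalB μ) n) g ∧
        |pmean (prodPair μ n) (fun p => f₁ p.1 * g₁ p.2) -
          pmean (prodPair μ n) (fun p => f p.1 * g p.2)| ≤ lam ∧
        (∃ fLow : (Fin n → A) → ℝ, degLE d fLow ∧
          pmean (prodDist (marginalA μ) n) (fun x => (f₁ x - fLow x) ^ 2) ≤ η) ∧
        (∃ gLow : (Fin n → B) → ℝ, degLE d gLow ∧
          pmean (prodDist (marginalB μ) n) (fun y => (g₁ y - gLow y) ^ 2) ≤ η) := by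
  have hA := hμ.marginalA
  have hB := hμ.marginalB
  have hr0 : 0 ≤ max (maxCorr μ) 0 := le_max_right _ _
  obtain ⟨s, hs0, hs1, hs⟩ := exists_noise_rate hr0 (max_lt hρ one_pos) hlam
  obtain ⟨d, hd⟩ := exists_pow_lt_of_lt_one hη hs1
  refine ⟨d, fun n f g hf hg => ⟨noiseOp (marginalA μ) s f, noiseOp (marginalB μ) s g,
    noiseOp_mem_Icc hA hs0 hs1.le hf, noiseOp_mem_Icc hB hs0 hs1.le hg, pmean_noiseOp hA s f,
    pmean_noiseOp hB s g, ?_, noiseOp_low_degree_approx hA hs0 hs1.le hd.le hf,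
    noiseOp_low_degree_approx hB hs0 hs1.le hd.le hg⟩⟩
  rw [pmean_prodPair, pmean_prodPair]
  exact abs_prodCorr_noiseOp_sub_le hμ hr0 (le_max_left _ _) hs0 hs1.le hlam.le hs hf hg

end NIS
end
end

section
/- Let (𝒜×ℬ, μ) be a finite joint probability space, d ∈ ℕ and τ > 0, and set η = τ²/16. Then there exists h = h(μ, d, τ) ∈ ℕ such that the following holds for all n. Suppose P : 𝒜^n → ℝ and Q : ℬ^n → ℝ satisfy Var[P] ≤ 1, Var[Q] ≤ 1, the squared L²(μ_A^{⊗n})-distance from P to the subspace of functions of degree at most d is at most η, and the squared L²(μ_B^{⊗n})-distance from Q to the subspace of functions of degree at most d is at most η. Then there exists H ⊆ [n] with |H| ≤ h such that, writing T = [n]∖H: with probability at least 1 − τ over ξ ∼ μ_A^{⊗H}, Inf_i(P_ξ) ≤ τ for all i ∈ T; and with probability at least 1 − τ over ξ ∼ μ_B^{⊗H}, Inf_i(Q_ξ) ≤ τ for all i ∈ T. -/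
open Finset MeasureTheory ProbabilityTheory Filter
open scoped Classical

noncomputable section

namespace NIS

section Averaging

variable {A : Type*} [Fintype A] {n : ℕ}

/-- Average of `f` over the coordinate `i`. -/
def coordAvg (p : A → ℝ) (i : Fin n) (f : (Fin n → A) → ℝ) : (Fin n → A) → ℝ :=
  fun x => ∑ a, p a * f (Function.update x i a)

lemma prodDist_nonneg {p : A → ℝ} (hp : IsDist p) (x : Fin n → A) : 0 ≤ prodDist p n x :=
  Finset.prod_nonneg fun i _ => hp.1 (x i)

lemma sum_prodDist {p : A → ℝ} (hp : IsDist p) : ∑ x, prodDist p n x = 1 := by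
  have h := Finset.prod_univ_sum (fun _ : Fin n => (Finset.univ : Finset A)) (fun _ a => p a)
  simp only [Fintype.piFinset_univ, hp.2, Finset.prod_const_one] at h
  exact h.symm

lemma prodDist_update (p : A → ℝ) (x : Fin n → A) (i : Fin n) (a : A) :
    prodDist p n (Function.update x i a) * p (x i) = prodDist p n x * p a := by
  unfold prodDist
  rw [← Finset.mul_prod_erase _ _ (Finset.mem_univ i),
    ← Finset.mul_prod_erase _ (fun j => p (x j)) (Finset.mem_univ i)]
  have h : ∏ j ∈ Finset.univ.erase i, p (Function.update x i a j)
      = ∏ j ∈ Finset.univ.erase i, p (x j) :=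
    Finset.prod_congr rfl fun j hj => by
      rw [Function.update_of_ne (Finset.ne_of_mem_erase hj)]
  rw [h, Function.update_self]
  ring

lemma sum_update_swap (p : A → ℝ) (i : Fin n) (F : (Fin n → A) → (Fin n → A) → ℝ) :
    ∑ x, ∑ a, prodDist p n x * p a * F x (Function.update x i a)
      = ∑ x, ∑ a, prodDist p n x * p a * F (Function.update x i a) x := by
  rw [← Fintype.sum_prod_type', ← Fintype.sum_prod_type']
  have hinv : Function.Involutive
      (fun z : (Fin n → A) × A => (Function.update z.1 i z.2, z.1 i)) := by
    rintro ⟨x, a⟩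
    simp
  refine Fintype.sum_equiv hinv.toPerm _ _ ?_
  rintro ⟨x, a⟩
  simp [prodDist_update]

lemma pmean_mul_coordAvg (p : A → ℝ) (i : Fin n) (f g : (Fin n → A) → ℝ) :
    pmean (prodDist p n) (fun x => f x * coordAvg p i g x)
      = ∑ x, ∑ a, prodDist p n x * p a * (f x * g (Function.update x i a)) := by
  unfold pmean coordAvg
  refine Finset.sum_congr rfl fun x _ => ?_
  simp only [Finset.mul_sum]
  exact Finset.sum_congr rfl fun a _ => by ring

lemma pmean_coordAvg_comm (p : A → ℝ) (i : Fin n) (f g : (Fin n → A) → ℝ) :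
    pmean (prodDist p n) (fun x => f x * coordAvg p i g x)
      = pmean (prodDist p n) (fun x => coordAvg p i f x * g x) := by
  simp_rw [mul_comm (coordAvg p i f _)]
  rw [pmean_mul_coordAvg, pmean_mul_coordAvg, sum_update_swap p i (fun x y => f x * g y)]
  simp_rw [mul_comm (f _)]

lemma coordAvg_comm (p : A → ℝ) {i j : Fin n} (hij : i ≠ j) (f : (Fin n → A) → ℝ) :
    coordAvg p i (coordAvg p j f) = coordAvg p j (coordAvg p i f) := by
  funext x
  unfold coordAvg
  simp_rw [Finset.mul_sum]
  rw [Finset.sum_comm]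
  refine Finset.sum_congr rfl fun a _ => Finset.sum_congr rfl fun b _ => ?_
  rw [Function.update_comm hij]
  ring

lemma coordAvg_of_update_eq {p : A → ℝ} (hp : IsDist p) {i : Fin n} {f : (Fin n → A) → ℝ}
    (hf : ∀ x a, f (Function.update x i a) = f x) : coordAvg p i f = f := by
  funext x
  simp only [coordAvg, hf, ← Finset.sum_mul, hp.2, one_mul]

lemma coordAvg_idem {p : A → ℝ} (hp : IsDist p) (i : Fin n) (f : (Fin n → A) → ℝ) :
    coordAvg p i (coordAvg p i f) = coordAvg p i f :=
  coordAvg_of_update_eq hp fun x a => by simp [coordAvg]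

/-- `coordAvg` as a linear map. -/
def coordAvgₗ (p : A → ℝ) (i : Fin n) : ((Fin n → A) → ℝ) →ₗ[ℝ] ((Fin n → A) → ℝ) where
  toFun := coordAvg p i
  map_add' f g := by
    funext x
    simp [coordAvg, mul_add, Finset.sum_add_distrib]
  map_smul' c f := by
    funext x
    simp [coordAvg, Finset.mul_sum, mul_left_comm]

lemma coordAvg_sub (p : A → ℝ) (i : Fin n) (f g : (Fin n → A) → ℝ) :
    coordAvg p i (f - g) = coordAvg p i f - coordAvg p i g :=
  (coordAvgₗ p i).map_sub f g

/-- The semi-inner product of `L²` of the product distribution. -/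
def prodInner (p : A → ℝ) (f g : (Fin n → A) → ℝ) : ℝ :=
  pmean (prodDist p n) (fun x => f x * g x)

lemma prodInner_comm (p : A → ℝ) (f g : (Fin n → A) → ℝ) :
    prodInner p f g = prodInner p g f := by
  simp only [prodInner, mul_comm]

lemma prodInner_sub_right (p : A → ℝ) (f g h : (Fin n → A) → ℝ) :
    prodInner p f (g - h) = prodInner p f g - prodInner p f h := by
  simp [prodInner, pmean, mul_sub, Finset.sum_sub_distrib]

lemma prodInner_sub_left (p : A → ℝ) (f g h : (Fin n → A) → ℝ) :
    prodInner p (f - g) h = prodInner p f h - prodInner p g h := by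
  rw [prodInner_comm, prodInner_sub_right, prodInner_comm p f, prodInner_comm p g]

lemma prodInner_self_nonneg {p : A → ℝ} (hp : IsDist p) (f : (Fin n → A) → ℝ) :
    0 ≤ prodInner p f f :=
  Finset.sum_nonneg fun x _ => mul_nonneg (prodDist_nonneg hp x) (mul_self_nonneg _)

lemma prodInner_coordAvg (p : A → ℝ) (i : Fin n) (f g : (Fin n → A) → ℝ) :
    prodInner p f (coordAvg p i g) = prodInner p (coordAvg p i f) g :=
  pmean_coordAvg_comm p i f g

lemma influence_eq {p : A → ℝ} (hp : IsDist p) (i : Fin n) (f : (Fin n → A) → ℝ) :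
    influence p i f = prodInner p f f - prodInner p f (coordAvg p i f) := by
  have hsq : ∑ x, ∑ a, prodDist p n x * p a * f x ^ 2 = prodInner p f f := by
    refine Finset.sum_congr rfl fun x _ => ?_
    simp only [mul_assoc]
    rw [← Finset.mul_sum, ← Finset.sum_mul, hp.2]
    ring
  have hswap := sum_update_swap p i (fun x _ => f x ^ 2)
  have hcross : prodInner p f (coordAvg p i f) = _ := pmean_mul_coordAvg p i f f
  have hexp : influence p i f = 1 / 2 * (∑ x, ∑ a, prodDist p n x * p a * f x ^ 2
      + ∑ x, ∑ a, prodDist p n x * p a * f (Function.update x i a) ^ 2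
      - 2 * ∑ x, ∑ a, prodDist p n x * p a * (f x * f (Function.update x i a))) := by
    simp only [influence, prodDist, Finset.mul_sum, ← Finset.sum_add_distrib,
      ← Finset.sum_sub_distrib]
    exact Finset.sum_congr rfl fun x _ => Finset.sum_congr rfl fun a _ => by ring
  rw [hexp, ← hswap, ← hcross, hsq]
  ring

lemma influence_nonneg {p : A → ℝ} (hp : IsDist p) (i : Fin n) (f : (Fin n → A) → ℝ) :
    0 ≤ influence p i f :=
  mul_nonneg (by norm_num) <| Finset.sum_nonneg fun x _ => Finset.sum_nonneg fun a _ =>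
    mul_nonneg (mul_nonneg (prodDist_nonneg hp x) (hp.1 a)) (sq_nonneg _)

lemma influence_le_prodInner {p : A → ℝ} (hp : IsDist p) (i : Fin n) (f : (Fin n → A) → ℝ) :
    influence p i f ≤ prodInner p f f := by
  have h : prodInner p f (coordAvg p i f) = prodInner p (coordAvg p i f) (coordAvg p i f) := by
    rw [← prodInner_coordAvg, coordAvg_idem hp]
  rw [influence_eq hp, h]
  linarith [prodInner_self_nonneg hp (coordAvg p i f)]

lemma influence_add_le {p : A → ℝ} (hp : IsDist p) (i : Fin n) (f g : (Fin n → A) → ℝ) :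
    influence p i (f + g) ≤ 2 * influence p i f + 2 * influence p i g := by
  simp only [influence, Finset.mul_sum, ← Finset.sum_add_distrib]
  refine Finset.sum_le_sum fun x _ => Finset.sum_le_sum fun a _ => ?_
  have hw : 0 ≤ (∏ j, p (x j)) * p a := mul_nonneg (prodDist_nonneg hp x) (hp.1 a)
  simp only [Pi.add_apply]
  nlinarith [mul_nonneg hw (sq_nonneg
    ((f x - f (Function.update x i a)) - (g x - g (Function.update x i a))))]

/-- The functions in the span of those depending on a set of coordinates that meets `T` in at
most `d` points. -/
def degSubmodule (A : Type*) {n : ℕ} (T : Finset (Fin n)) (d : ℕ) :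
    Submodule ℝ ((Fin n → A) → ℝ) :=
  Submodule.span ℝ { g | ∃ J : Finset (Fin n), (J ∩ T).card ≤ d ∧
    ∀ x y : Fin n → A, (∀ i ∈ J, x i = y i) → g x = g y }

lemma coordAvg_mem_degSubmodule (p : A → ℝ) {j : Fin n} {T : Finset (Fin n)} {d : ℕ}
    {f : (Fin n → A) → ℝ} (hf : f ∈ degSubmodule A (insert j T) d) :
    coordAvg p j f ∈ degSubmodule A T d := by
  refine Submodule.span_le (p := (degSubmodule A T d).comap (coordAvgₗ p j)).2 ?_ hf
  rintro g ⟨J, hJ, hg⟩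
  refine Submodule.subset_span ⟨J, (Finset.card_le_card
    (Finset.inter_subset_inter_left (Finset.subset_insert j T))).trans hJ, fun x y hxy => ?_⟩
  refine Finset.sum_congr rfl fun a _ => ?_
  rw [hg (Function.update x j a) (Function.update y j a) fun i hi => ?_]
  by_cases hij : i = j
  · subst hij; simp
  · simp [hij, hxy i hi]

lemma sub_coordAvg_eq_zero {p : A → ℝ} (hp : IsDist p) {j : Fin n} {J : Finset (Fin n)}
    (hj : j ∉ J) {g : (Fin n → A) → ℝ}
    (hg : ∀ x y : Fin n → A, (∀ i ∈ J, x i = y i) → g x = g y) :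
    g - coordAvg p j g = 0 := by
  rw [coordAvg_of_update_eq hp, sub_self]
  intro x a
  exact hg _ _ fun i hi => Function.update_of_ne (ne_of_mem_of_not_mem hi hj) _ _

lemma sub_coordAvg_mem_degSubmodule {p : A → ℝ} (hp : IsDist p) {j : Fin n}
    {T : Finset (Fin n)} (hjT : j ∉ T) {d : ℕ} {f : (Fin n → A) → ℝ}
    (hf : f ∈ degSubmodule A (insert j T) (d + 1)) :
    f - coordAvg p j f ∈ degSubmodule A T d := by
  refine Submodule.span_le
    (p := (degSubmodule A T d).comap (LinearMap.id - coordAvgₗ p j)).2 ?_ hf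
  rintro g ⟨J, hJ, hg⟩
  change g - coordAvg p j g ∈ degSubmodule A T d
  by_cases hj : j ∈ J
  · refine Submodule.subset_span ⟨J, ?_, fun x y hxy => ?_⟩
    · rw [Finset.inter_insert_of_mem hj, Finset.card_insert_of_notMem
        (fun h => hjT (Finset.mem_inter.1 h).2)] at hJ
      omega
    · have h : coordAvg p j g x = coordAvg p j g y := by
        refine Finset.sum_congr rfl fun a _ => ?_
        rw [hg (Function.update x j a) (Function.update y j a) fun i hi => ?_]
        by_cases hij : i = j
        · subst hij; simp
        · simp [hij, hxy i hi]
      simp [h, hg x y hxy]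
  · rw [sub_coordAvg_eq_zero hp hj hg]
    exact Submodule.zero_mem _

lemma sub_coordAvg_eq_zero_of_mem {p : A → ℝ} (hp : IsDist p) {j : Fin n}
    {T : Finset (Fin n)} {f : (Fin n → A) → ℝ}
    (hf : f ∈ degSubmodule A (insert j T) 0) : f - coordAvg p j f = 0 := by
  refine Submodule.span_le
    (p := LinearMap.ker (LinearMap.id - coordAvgₗ p j)).2 ?_ hf
  rintro g ⟨J, hJ, hg⟩
  refine sub_coordAvg_eq_zero hp (fun hj => ?_) hg
  have h : j ∈ J ∩ insert j T := Finset.mem_inter.2 ⟨hj, Finset.mem_insert_self j T⟩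
  exact absurd (Finset.card_pos.2 ⟨j, h⟩) (by omega)

lemma prodInner_self_eq_add {p : A → ℝ} (hp : IsDist p) (j : Fin n) (f : (Fin n → A) → ℝ) :
    prodInner p f f = prodInner p (coordAvg p j f) (coordAvg p j f)
      + prodInner p (f - coordAvg p j f) (f - coordAvg p j f) := by
  have h : prodInner p (coordAvg p j f) (coordAvg p j f) = prodInner p f (coordAvg p j f) := by
    rw [← prodInner_coordAvg, coordAvg_idem hp]
  simp only [prodInner_sub_left, prodInner_sub_right, h, prodInner_comm p (coordAvg p j f) f]
  ring

lemma influence_self_eq {p : A → ℝ} (hp : IsDist p) (j : Fin n) (f : (Fin n → A) → ℝ) :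
    influence p j f = prodInner p (f - coordAvg p j f) (f - coordAvg p j f) := by
  have h : prodInner p (coordAvg p j f) (coordAvg p j f) = prodInner p f (coordAvg p j f) := by
    rw [← prodInner_coordAvg, coordAvg_idem hp]
  rw [influence_eq hp]
  simp only [prodInner_sub_left, prodInner_sub_right, h, prodInner_comm p (coordAvg p j f) f]
  ring

lemma influence_eq_add {p : A → ℝ} (hp : IsDist p) {i j : Fin n} (hij : i ≠ j)
    (f : (Fin n → A) → ℝ) :
    influence p i f = influence p i (coordAvg p j f) + influence p i (f - coordAvg p j f) := by
  set u := coordAvg p j f with hu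
  have hz : prodInner p u (coordAvg p i u) = prodInner p f (coordAvg p i u) := by
    rw [hu, coordAvg_comm p hij, ← prodInner_coordAvg, coordAvg_idem hp]
  have hz' : prodInner p u (coordAvg p i f) = prodInner p f (coordAvg p i u) := by
    rw [hu, ← prodInner_coordAvg, coordAvg_comm p hij]
  simp only [influence_eq hp, coordAvg_sub, prodInner_sub_left, prodInner_sub_right]
  have huu : prodInner p u u = prodInner p f u := by
    rw [hu, ← prodInner_coordAvg, coordAvg_idem hp]
  rw [hz, hz', huu, prodInner_comm p u f]
  ring

lemma sum_influence_le {p : A → ℝ} (hp : IsDist p) (T : Finset (Fin n)) :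
    ∀ (d : ℕ) (f : (Fin n → A) → ℝ), f ∈ degSubmodule A T d →
      ∑ i ∈ T, influence p i f ≤ d * prodInner p f f := by
  induction T using Finset.induction_on with
  | empty =>
    intro d f _
    simpa using mul_nonneg (Nat.cast_nonneg d) (prodInner_self_nonneg hp f)
  | insert j T hj ih =>
    intro d f hf
    have hsplit : ∑ i ∈ T, influence p i f = ∑ i ∈ T, influence p i (coordAvg p j f)
        + ∑ i ∈ T, influence p i (f - coordAvg p j f) := by
      rw [← Finset.sum_add_distrib]
      exact Finset.sum_congr rfl fun i hi => influence_eq_add hp (ne_of_mem_of_not_mem hi hj) f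
    have h₀ := ih d _ (coordAvg_mem_degSubmodule p hf)
    have h₁ : ∑ i ∈ T, influence p i (f - coordAvg p j f)
        + prodInner p (f - coordAvg p j f) (f - coordAvg p j f)
        ≤ d * prodInner p (f - coordAvg p j f) (f - coordAvg p j f) := by
      cases d with
      | zero =>
        rw [sub_coordAvg_eq_zero_of_mem hp hf]
        simp [influence, prodInner, pmean]
      | succ d =>
        have := ih d _ (sub_coordAvg_mem_degSubmodule hp hj hf)
        push_cast
        linarith
    rw [Finset.sum_insert hj, hsplit, influence_self_eq hp, prodInner_self_eq_add hp j f]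
    linarith

lemma totalInfluence_le_of_degLE {p : A → ℝ} (hp : IsDist p) {d : ℕ}
    {f : (Fin n → A) → ℝ} (hf : degLE d f) :
    totalInfluence p f ≤ d * prodInner p f f :=
  sum_influence_le hp Finset.univ d f <| by
    simpa only [degSubmodule, Finset.inter_univ, degLE, DependsOnLE] using hf

lemma totalInfluence_sub_const (p : A → ℝ) (f : (Fin n → A) → ℝ) (c : ℝ) :
    totalInfluence p (fun x => f x - c) = totalInfluence p f := by
  simp [totalInfluence, influence]

lemma degLE_sub_const {A : Type*} {n d : ℕ} {f : (Fin n → A) → ℝ} (hf : degLE d f) (c : ℝ) :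
    degLE d (fun x => f x - c) :=
  Submodule.sub_mem _ hf (Submodule.subset_span ⟨∅, by simp, fun _ _ _ => rfl⟩)

lemma totalInfluence_le_of_close {p : A → ℝ} (hp : IsDist p) {d : ℕ} {ε : ℝ}
    {f g : (Fin n → A) → ℝ} (hf : pvar (prodDist p n) f ≤ 1) (hg : degLE d g)
    (hfg : pmean (prodDist p n) (fun x => (f x - g x) ^ 2) ≤ ε) :
    totalInfluence p g ≤ d * (2 + 2 * ε) := by
  set c := pmean (prodDist p n) f with hc
  rw [← totalInfluence_sub_const p g c]
  refine (totalInfluence_le_of_degLE hp (degLE_sub_const hg c)).trans ?_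
  refine mul_le_mul_of_nonneg_left ?_ (Nat.cast_nonneg d)
  have h : prodInner p (fun x => g x - c) (fun x => g x - c)
      ≤ 2 * pvar (prodDist p n) f + 2 * pmean (prodDist p n) (fun x => (f x - g x) ^ 2) := by
    simp only [prodInner, pvar, ← hc]
    simp only [pmean, Finset.mul_sum, ← Finset.sum_add_distrib]
    refine Finset.sum_le_sum fun x _ => ?_
    nlinarith [mul_nonneg (prodDist_nonneg hp x) (sq_nonneg ((f x - c) + (f x - g x)))]
  linarith

end Averaging

section Restriction

variable {A : Type*} [Fintype A] {n : ℕ}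

lemma prodDist_mul_merge (p : A → ℝ) (H : Finset (Fin n)) (x y : Fin n → A) :
    prodDist p n (fun i => if i ∈ H then x i else y i)
      * prodDist p n (fun i => if i ∈ H then y i else x i)
      = prodDist p n x * prodDist p n y := by
  simp only [prodDist, ← Finset.prod_mul_distrib]
  refine Finset.prod_congr rfl fun i _ => ?_
  split_ifs <;> ring

lemma pmean_pmean_restrictFn {p : A → ℝ} (hp : IsDist p) (H : Finset (Fin n))
    (f : (Fin n → A) → ℝ) :
    pmean (prodDist p n) (fun ξ => pmean (prodDist p n) (restrictFn H ξ f))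
      = pmean (prodDist p n) f := by
  have hinv : Function.Involutive (fun z : (Fin n → A) × (Fin n → A) =>
      ((fun i => if i ∈ H then z.1 i else z.2 i : Fin n → A),
        (fun i => if i ∈ H then z.2 i else z.1 i : Fin n → A))) := by
    rintro ⟨x, y⟩
    ext i
    all_goals
      dsimp only
      split_ifs <;> rfl
  calc pmean (prodDist p n) (fun ξ => pmean (prodDist p n) (restrictFn H ξ f))
      = ∑ z : (Fin n → A) × (Fin n → A), prodDist p n z.1 * prodDist p n z.2
          * f (fun i => if i ∈ H then z.1 i else z.2 i) := by
        simp only [pmean, Fintype.sum_prod_type, Finset.mul_sum, restrictFn, mul_assoc]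
    _ = ∑ z : (Fin n → A) × (Fin n → A), prodDist p n z.1 * prodDist p n z.2 * f z.1 := by
        refine Fintype.sum_equiv hinv.toPerm _ _ ?_
        rintro ⟨x, y⟩
        simp only [Function.Involutive.coe_toPerm]
        rw [prodDist_mul_merge]
    _ = pmean (prodDist p n) f := by
        rw [Fintype.sum_prod_type]
        refine Finset.sum_congr rfl fun x _ => ?_
        simp only [← Finset.sum_mul, ← Finset.mul_sum, sum_prodDist hp, mul_one]

lemma pmean_influence_restrictFn {p : A → ℝ} (hp : IsDist p) {H : Finset (Fin n)} {i : Fin n}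
    (hi : i ∉ H) (f : (Fin n → A) → ℝ) :
    pmean (prodDist p n) (fun ξ => influence p i (restrictFn H ξ f)) = influence p i f := by
  have key : ∀ g : (Fin n → A) → ℝ, influence p i g = pmean (prodDist p n)
      (fun x => ∑ a, 1 / 2 * (p a * (g x - g (Function.update x i a)) ^ 2)) := by
    intro g
    simp only [influence, pmean, prodDist, Finset.mul_sum]
    exact Finset.sum_congr rfl fun x _ => Finset.sum_congr rfl fun a _ => by ring
  rw [key f, ← pmean_pmean_restrictFn hp H (fun x => ∑ a, _)]
  congr 1
  funext ξ
  rw [key]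
  congr 1
  funext x
  refine Finset.sum_congr rfl fun a _ => ?_
  have h : (fun j => if j ∈ H then ξ j else Function.update x i a j)
      = Function.update (fun j => if j ∈ H then ξ j else x j) i a := by
    funext j
    by_cases hj : j = i
    · subst hj; simp [hi]
    · simp [hj]
  simp only [restrictFn, h]

lemma restrictFn_congr {A : Type*} {n : ℕ} {H : Finset (Fin n)} {ξ ξ' : Fin n → A} (h : ∀ i ∈ H, ξ i = ξ' i)
    (f : (Fin n → A) → ℝ) : restrictFn H ξ f = restrictFn H ξ' f := by
  funext x
  unfold restrictFn
  congr 1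
  funext i
  split_ifs with hi
  · exact h i hi
  · rfl

/-- A small set of coordinates containing an influential one for each restriction that has one. -/
lemma exists_influential_coords (p : A → ℝ) (H : Finset (Fin n)) (f : (Fin n → A) → ℝ) (τ : ℝ) :
    ∃ N : Finset (Fin n), N.card ≤ Fintype.card A ^ H.card ∧ Disjoint H N ∧
      ∀ ξ, (∃ i ∉ H, τ < influence p i (restrictFn H ξ f)) →
        ∃ i ∈ N, τ < influence p i (restrictFn H ξ f) := by
  have hloc : ∀ ρ : H → A, ∃ S : Finset (Fin n), S.card ≤ 1 ∧ Disjoint H S ∧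
      ∀ ξ : Fin n → A, (∀ i : H, ξ i = ρ i) →
        (∃ i ∉ H, τ < influence p i (restrictFn H ξ f)) →
        ∃ i ∈ S, τ < influence p i (restrictFn H ξ f) := by
    intro ρ
    by_cases hex : ∃ ξ : Fin n → A, (∀ i : H, ξ i = ρ i) ∧
        ∃ i ∉ H, τ < influence p i (restrictFn H ξ f)
    · obtain ⟨ξ, hξ, i, hi, hτ⟩ := hex
      refine ⟨{i}, by simp, by simpa using hi, fun ξ' hξ' _ => ⟨i, by simp, ?_⟩⟩
      rwa [restrictFn_congr fun j hj => (hξ' ⟨j, hj⟩).trans (hξ ⟨j, hj⟩).symm]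
    · exact ⟨∅, by simp, by simp, fun ξ hξ h => absurd ⟨ξ, hξ, h⟩ hex⟩
  choose S hcard hdisj hS using hloc
  refine ⟨Finset.univ.biUnion S, ?_, ?_, fun ξ hξ => ?_⟩
  · refine (Finset.card_biUnion_le_card_mul _ _ 1 fun ρ _ => hcard ρ).trans ?_
    simp
  · exact (Finset.disjoint_biUnion_right _ _ _).2 fun ρ _ => hdisj ρ
  · obtain ⟨i, hi, h⟩ := hS (fun j => ξ j) ξ (fun _ => rfl) hξ
    exact ⟨i, Finset.mem_biUnion.2 ⟨_, Finset.mem_univ _, hi⟩, h⟩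

lemma good_or_exists_influence_increment {p : A → ℝ} (hp : IsDist p) {τ : ℝ} (hτ : 0 < τ)
    (H : Finset (Fin n)) (f g : (Fin n → A) → ℝ)
    (hfg : pmean (prodDist p n) (fun x => (f x - g x) ^ 2) ≤ τ ^ 2 / 16) :
    pprob (prodDist p n) (fun ξ => ∀ i ∉ H, influence p i (restrictFn H ξ f) ≤ τ) ≥ 1 - τ ∨
      ∃ N : Finset (Fin n), N.card ≤ Fintype.card A ^ H.card ∧ Disjoint H N ∧
        τ ^ 2 / 4 ≤ ∑ i ∈ N, influence p i g := by
  obtain ⟨N, hcard, hdisj, hN⟩ := exists_influential_coords p H f τ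
  refine or_iff_not_imp_left.2 fun hbad => ⟨N, hcard, hdisj, ?_⟩
  rw [not_le] at hbad
  set r : (Fin n → A) → ℝ := fun x => f x - g x with hr
  have hpt : ∀ ξ, τ - τ * (if ∀ i ∉ H, influence p i (restrictFn H ξ f) ≤ τ then 1 else 0)
      ≤ 2 * ∑ i ∈ N, influence p i (restrictFn H ξ g)
        + 2 * pmean (prodDist p n) (restrictFn H ξ (fun x => r x ^ 2)) := by
    intro ξ
    have hsq : prodInner p (restrictFn H ξ r) (restrictFn H ξ r)
        = pmean (prodDist p n) (restrictFn H ξ (fun x => r x ^ 2)) := by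
      unfold prodInner restrictFn
      simp only [sq]
    have hr0 := prodInner_self_nonneg hp (restrictFn H ξ r)
    have hs0 : 0 ≤ ∑ i ∈ N, influence p i (restrictFn H ξ g) :=
      Finset.sum_nonneg fun i _ => influence_nonneg hp i _
    split_ifs with hgood
    · linarith
    · push Not at hgood
      obtain ⟨i, hi, hlt⟩ := hN ξ hgood
      have hsum : restrictFn H ξ f = restrictFn H ξ g + restrictFn H ξ r := by
        funext x
        simp [restrictFn, hr]
      have h₁ := influence_add_le hp i (restrictFn H ξ g) (restrictFn H ξ r)
      rw [← hsum] at h₁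
      have h₂ := influence_le_prodInner hp i (restrictFn H ξ r)
      have h₃ := Finset.single_le_sum
        (f := fun i => influence p i (restrictFn H ξ g))
        (fun i _ => influence_nonneg hp i _) hi
      linarith
  have hmean := Finset.sum_le_sum fun ξ (_ : ξ ∈ Finset.univ) =>
    mul_le_mul_of_nonneg_left (hpt ξ) (prodDist_nonneg hp ξ)
  have hleft : ∑ ξ, prodDist p n ξ *
      (τ - τ * (if ∀ i ∉ H, influence p i (restrictFn H ξ f) ≤ τ then 1 else 0))
      = τ - τ * pprob (prodDist p n)
          (fun ξ => ∀ i ∉ H, influence p i (restrictFn H ξ f) ≤ τ) := by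
    simp only [mul_sub, Finset.sum_sub_distrib, ← Finset.sum_mul, sum_prodDist hp, one_mul]
    congr 1
    rw [pprob, Finset.mul_sum]
    refine Finset.sum_congr rfl fun ξ _ => ?_
    split_ifs <;> ring
  have hright : ∑ ξ, prodDist p n ξ * (2 * ∑ i ∈ N, influence p i (restrictFn H ξ g)
        + 2 * pmean (prodDist p n) (restrictFn H ξ (fun x => r x ^ 2)))
      = 2 * ∑ i ∈ N, influence p i g + 2 * pmean (prodDist p n) (fun x => r x ^ 2) := by
    rw [← pmean_pmean_restrictFn hp H (fun x => r x ^ 2)]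
    have hN' : ∑ i ∈ N, influence p i g
        = ∑ i ∈ N, pmean (prodDist p n) (fun ξ => influence p i (restrictFn H ξ g)) :=
      Finset.sum_congr rfl fun i hi => (pmean_influence_restrictFn hp
        (fun h => Finset.disjoint_left.1 hdisj h hi) g).symm
    rw [hN']
    simp only [pmean, mul_add, Finset.sum_add_distrib]
    rw [Finset.sum_comm]
    simp only [Finset.mul_sum, mul_left_comm]
  rw [hleft, hright] at hmean
  nlinarith [mul_lt_mul_of_pos_left hbad hτ]

end Restriction

section Iteration

/-- Size bound after `k` steps of adding at most `c ^ m` elements to a set of size `m`. -/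
def towerBound (c : ℕ) : ℕ → ℕ
  | 0 => 0
  | k + 1 => towerBound c k + c ^ towerBound c k

lemma exists_card_le_of_increment {ι : Type*} [Fintype ι] {c K : ℕ} (hc : 0 < c) {δ : ℝ}
    {u : ι → ℝ} (hu : ∀ i, 0 ≤ u i) (hK : ∑ i, u i < K * δ) {good : Finset ι → Prop}
    (step : ∀ H, good H ∨ ∃ N : Finset ι, N.card ≤ c ^ H.card ∧ Disjoint H N ∧
      δ ≤ ∑ i ∈ N, u i) :
    ∃ H : Finset ι, H.card ≤ towerBound c K ∧ good H := by
  have hiter : ∀ k : ℕ, ∃ H : Finset ι, H.card ≤ towerBound c k ∧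
      (good H ∨ k * δ ≤ ∑ i ∈ H, u i) := by
    intro k
    induction k with
    | zero => exact ⟨∅, by simp, Or.inr (by simp)⟩
    | succ k ih =>
      obtain ⟨H, hcard, hH⟩ := ih
      have hmono : towerBound c k ≤ towerBound c (k + 1) := Nat.le_add_right _ _
      rcases hH with hH | hH
      · exact ⟨H, hcard.trans hmono, Or.inl hH⟩
      · rcases step H with hg | ⟨N, hN, hdisj, hδ⟩
        · exact ⟨H, hcard.trans hmono, Or.inl hg⟩
        · refine ⟨H ∪ N, ?_, Or.inr ?_⟩
          · exact (Finset.card_union_le H N).trans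
              (add_le_add hcard (hN.trans (Nat.pow_le_pow_right hc hcard)))
          · rw [Finset.sum_union hdisj]
            push_cast
            linarith
  obtain ⟨H, hcard, hH | hH⟩ := hiter K
  · exact ⟨H, hcard, hH⟩
  · have := Finset.sum_le_sum_of_subset_of_nonneg (Finset.subset_univ H) fun i _ _ => hu i
    linarith

end Iteration

lemma isDist_marginalA {A B : Type*} [Fintype A] [Fintype B] {μ : A × B → ℝ} (hμ : IsDist μ) :
    IsDist (marginalA μ) :=
  ⟨fun _ => Finset.sum_nonneg fun _ _ => hμ.1 _, by
    simpa only [marginalA, Fintype.sum_prod_type] using hμ.2⟩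

lemma isDist_marginalB {A B : Type*} [Fintype A] [Fintype B] {μ : A × B → ℝ} (hμ : IsDist μ) :
    IsDist (marginalB μ) :=
  ⟨fun _ => Finset.sum_nonneg fun _ _ => hμ.1 _, by
    simpa only [marginalB, Fintype.sum_prod_type_right] using hμ.2⟩

/-- Joint regularity lemma for Fourier-concentrated functions (Lemma 5.1), with
`η = τ²/16`: for `P, Q` of variance at most 1 that are `η`-close in squared L² distance to the
degree-`d` subspace, there is a common set `H` of at most `h` coordinates whose random
restriction leaves all remaining influences of `P` (resp. `Q`) at most `τ`, each with
probability at least `1 - τ`. -/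
theorem stmt5 {A B : Type*} [Fintype A] [Fintype B] (μ : A × B → ℝ) (hμ : IsDist μ)
    (d : ℕ) (τ : ℝ) (hτ : 0 < τ) :
    ∃ h : ℕ, ∀ n : ℕ, ∀ P : (Fin n → A) → ℝ, ∀ Q : (Fin n → B) → ℝ,
      pvar (prodDist (marginalA μ) n) P ≤ 1 → pvar (prodDist (marginalB μ) n) Q ≤ 1 →
      (∃ PLow : (Fin n → A) → ℝ, degLE d PLow ∧
        pmean (prodDist (marginalA μ) n) (fun x => (P x - PLow x) ^ 2) ≤ τ ^ 2 / 16) →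
      (∃ QLow : (Fin n → B) → ℝ, degLE d QLow ∧
        pmean (prodDist (marginalB μ) n) (fun y => (Q y - QLow y) ^ 2) ≤ τ ^ 2 / 16) →
      ∃ H : Finset (Fin n), H.card ≤ h ∧
        pprob (prodDist (marginalA μ) n)
          (fun ξ => ∀ i ∉ H, influence (marginalA μ) i (restrictFn H ξ P) ≤ τ) ≥ 1 - τ ∧
        pprob (prodDist (marginalB μ) n)
          (fun ξ => ∀ i ∉ H, influence (marginalB μ) i (restrictFn H ξ Q) ≤ τ) ≥ 1 - τ := by
  have hA := isDist_marginalA hμ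
  have hB := isDist_marginalB hμ
  have hδ : 0 < τ ^ 2 / 4 := by positivity
  obtain ⟨K, hK⟩ := exists_nat_gt (2 * (d * (2 + 2 * (τ ^ 2 / 16))) / (τ ^ 2 / 4))
  rw [div_lt_iff₀ hδ] at hK
  refine ⟨towerBound (Fintype.card A + Fintype.card B + 1) K, ?_⟩
  rintro n P Q hP hQ ⟨PLow, hPdeg, hPclose⟩ ⟨QLow, hQdeg, hQclose⟩
  have hPtot := totalInfluence_le_of_close hA hP hPdeg hPclose
  have hQtot := totalInfluence_le_of_close hB hQ hQdeg hQclose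
  refine exists_card_le_of_increment (Nat.succ_pos _)
    (u := fun i => influence (marginalA μ) i PLow + influence (marginalB μ) i QLow)
    (fun i => add_nonneg (influence_nonneg hA i _) (influence_nonneg hB i _))
    (lt_of_le_of_lt ?_ hK) fun H => ?_
  · rw [Finset.sum_add_distrib, two_mul]
    exact add_le_add hPtot hQtot
  · rcases good_or_exists_influence_increment hA hτ H P PLow hPclose with
      hgP | ⟨N, hN, hdisj, hinc⟩
    · rcases good_or_exists_influence_increment hB hτ H Q QLow hQclose with
        hgQ | ⟨N, hN, hdisj, hinc⟩
      · exact Or.inl ⟨hgP, hgQ⟩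
      · exact Or.inr ⟨N, hN.trans (Nat.pow_le_pow_left (by omega) _), hdisj, hinc.trans
          (Finset.sum_le_sum fun i _ => le_add_of_nonneg_left (influence_nonneg hA i _))⟩
    · exact Or.inr ⟨N, hN.trans (Nat.pow_le_pow_left (by omega) _), hdisj, hinc.trans
        (Finset.sum_le_sum fun i _ => le_add_of_nonneg_right (influence_nonneg hB i _))⟩

end NIS
end
end
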